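/- arXiv:1711.01193 — 2 statements merged into one kernel-verified Lean document; each statement's English description precedes it below -/
import Mathlib

section
/- Thermodynamic interconversion criterion: for probability vectors p, q ∈ ℝ^d and a fixed probability vector γ ∈ ℝ^d with rational entries γ_i = D_i/D, there exists a stochastic matrix Λ ∈ ℝ^{d×d} (Λ_{ij} ≥ 0 and Σ_i Λ_{ij} = 1 for every j) with Λγ = γ and Λp = q if and only if Γp ≻ Γq. -/
open Finset Filter

noncomputable section

/-- A probability vector: nonnegative entries summing to 1. -/
def IsProbVec {ι : Type*} [Fintype ι] (p : ι → ℝ) : Prop :=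
  (∀ i, 0 ≤ p i) ∧ ∑ i, p i = 1

/-- The sum of the `k` largest entries of `p`: the largest sum over subsets of at
most `k` indices (for nonnegative vectors this equals the sorted partial sum,
with zero padding beyond the dimension). -/
def kMaxSum {ι : Type*} [Fintype ι] (p : ι → ℝ) (k : ℕ) : ℝ :=
  (Finset.univ.powerset.filter (fun s : Finset ι => s.card ≤ k)).sup'
    ⟨∅, by simp⟩ (fun s => ∑ i ∈ s, p i)

/-- `p ≻ q`: for every `k`, the sum of the `k` largest entries of `p` is at least
that of `q` (dimensions may differ, the shorter padded with zeros). -/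
def Majorises {ι κ : Type*} [Fintype ι] [Fintype κ] (p : ι → ℝ) (q : κ → ℝ) : Prop :=
  ∀ k : ℕ, kMaxSum q k ≤ kMaxSum p k

/-- Fidelity `F(p,q) = (Σ_i √(p_i q_i))²`. -/
def fidelity {ι : Type*} [Fintype ι] (p q : ι → ℝ) : ℝ :=
  (∑ i, Real.sqrt (p i * q i)) ^ 2

/-- Infidelity `δ(p,q) = 1 - F(p,q)`. -/
def infid {ι : Type*} [Fintype ι] (p q : ι → ℝ) : ℝ := 1 - fidelity p q

/-- The embedding map `Γ`: given block sizes `Dc i` (with `∑ i, Dc i = D`) and a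
block-assignment `blk : Fin D → Fin d` hitting each `i` exactly `Dc i` times,
`Γp` repeats the value `p i / Dc i` exactly `Dc i` times. -/
def embedMap {d D : ℕ} (Dc : Fin d → ℕ) (blk : Fin D → Fin d) (p : Fin d → ℝ) :
    Fin D → ℝ :=
  fun j => p (blk j) / (Dc (blk j) : ℝ)

open Matrix

section Majorisation

variable {ι : Type*} [Fintype ι]

lemma sum_le_kMaxSum (x : ι → ℝ) {k : ℕ} {s : Finset ι} (hs : s.card ≤ k) :
    ∑ i ∈ s, x i ≤ kMaxSum x k :=
  Finset.le_sup' (fun s => ∑ i ∈ s, x i) (by simpa using hs)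

lemma kMaxSum_le {x : ι → ℝ} {k : ℕ} {b : ℝ}
    (h : ∀ s : Finset ι, s.card ≤ k → ∑ i ∈ s, x i ≤ b) : kMaxSum x k ≤ b :=
  Finset.sup'_le _ _ fun s hs => h s (by simpa using hs)

lemma kMaxSum_comp_equiv_le (x : ι → ℝ) (σ : Equiv.Perm ι) (k : ℕ) :
    kMaxSum (x ∘ σ) k ≤ kMaxSum x k :=
  kMaxSum_le fun s hs => by
    simpa using sum_le_kMaxSum x (s := s.map σ.toEmbedding) (by simpa using hs)

/-- A doubly stochastic image of a vector is majorised by that vector. -/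
lemma majorises_mulVec_of_mem_doublyStochastic [DecidableEq ι] {M : Matrix ι ι ℝ}
    (hM : M ∈ doublyStochastic ℝ ι) (x : ι → ℝ) : Majorises x (M *ᵥ x) := by
  intro k
  obtain ⟨w, hw, hw1, rfl⟩ := exists_eq_sum_perm_of_mem_doublyStochastic hM
  refine kMaxSum_le fun s hs => ?_
  calc ∑ i ∈ s, ((∑ σ, w σ • σ.permMatrix ℝ) *ᵥ x) i
      = ∑ σ, w σ * ∑ i ∈ s, (x ∘ σ) i := by
        simp only [sum_mulVec, smul_mulVec, permMatrix_mulVec, Finset.sum_apply, Pi.smul_apply,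
          smul_eq_mul, mul_sum]
        exact sum_comm
    _ ≤ ∑ σ, w σ * kMaxSum x k := by
        gcongr with σ
        · exact hw σ
        · exact (sum_le_kMaxSum _ hs).trans (kMaxSum_comp_equiv_le x σ k)
    _ = kMaxSum x k := by rw [← sum_mul, hw1, one_mul]

/-- For a nonnegative antitone vector, the `k` largest entries are the first `k` ones. -/
lemma kMaxSum_le_sum_of_antitone {n : ℕ} {z : Fin n → ℝ} (hz : Antitone z) (h0 : ∀ i, 0 ≤ z i)
    (k : ℕ) : kMaxSum z k ≤ ∑ i with i.val < k, z i := by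
  refine kMaxSum_le fun s hs => ?_
  rcases le_or_gt n k with hk | hk
  · exact sum_le_sum_of_subset_of_nonneg (fun i _ => by simp; omega) fun i _ _ => h0 i
  set t : Finset (Fin n) := {i | i.val < k}
  have ht : t.card = k := by simp [t, Fin.card_filter_val_lt, hk.le]
  have hcard : ((s \ t).card : ℝ) ≤ (t \ s).card := by
    rw [← ht] at hs
    exact_mod_cast card_sdiff_le_card_sdiff_iff.2 hs
  have hout : ∑ i ∈ s \ t, z i ≤ (s \ t).card • z ⟨k, hk⟩ :=
    sum_le_card_nsmul _ _ _ fun i hi => hz <| by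
      simp only [t, Finset.mem_sdiff, mem_filter_univ, not_lt] at hi
      exact hi.2
  have hin : (t \ s).card • z ⟨k, hk⟩ ≤ ∑ i ∈ t \ s, z i :=
    card_nsmul_le_sum _ _ _ fun i hi => hz <| by
      simp only [t, Finset.mem_sdiff, mem_filter_univ] at hi
      exact hi.1.le
  rw [← sum_inter_add_sum_sdiff s t, ← sum_inter_add_sum_sdiff t s, inter_comm t s]
  simp only [nsmul_eq_mul] at hin hout
  have := mul_le_mul_of_nonneg_right hcard (h0 ⟨k, hk⟩)
  linarith

/-- An inequality form of summation by parts. -/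
lemma mul_sum_le_sum_mul_of_antitone {n : ℕ} {c a : Fin n → ℝ} (hc : Antitone c)
    (ha : ∀ k : ℕ, 0 ≤ ∑ i with i.val < k, a i) {t : ℝ} (ht : ∀ i, t ≤ c i) :
    t * ∑ i, a i ≤ ∑ i, c i * a i := by
  induction n generalizing t with
  | zero => simp
  | succ n ih =>
    have hlast := ih (c := c ∘ Fin.castSucc) (a := a ∘ Fin.castSucc)
      (hc.comp_monotone Fin.strictMono_castSucc.monotone)
      (fun k => by
        have := ha (min k n)
        rw [sum_filter, Fin.sum_univ_castSucc] at this
        simpa [sum_filter] using this)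
      (t := c (Fin.last n)) (fun i => hc (Fin.le_last _))
    have htot : 0 ≤ ∑ i, a i := by
      have := ha (n + 1)
      rwa [filter_true_of_mem fun i _ => i.isLt] at this
    refine (mul_le_mul_of_nonneg_right (ht (Fin.last n)) htot).trans ?_
    simp only [Fin.sum_univ_castSucc, mul_add, Function.comp_apply] at hlast ⊢
    linarith

lemma exists_perm_sum_mul_le {n : ℕ} {x y : Fin n → ℝ} (hx : ∀ i, 0 ≤ x i)
    (hsum : ∑ i, x i = ∑ i, y i) (h : Majorises x y) (c : Fin n → ℝ) :
    ∃ σ : Equiv.Perm (Fin n), ∑ i, c i * y i ≤ ∑ i, c i * x (σ i) := by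
  set τ := Tuple.sort (-c)
  set ρ := Tuple.sort (-x)
  have hτ : Antitone (c ∘ τ) := fun i j hij => neg_le_neg_iff.1 (Tuple.monotone_sort (-c) hij)
  have hρ : Antitone (x ∘ ρ) := fun i j hij => neg_le_neg_iff.1 (Tuple.monotone_sort (-x) hij)
  obtain ⟨t, ht⟩ := (Set.finite_range (c ∘ τ)).bddBelow
  have key := mul_sum_le_sum_mul_of_antitone (a := fun i => x (ρ i) - y (τ i)) hτ
    (fun k => by
      rw [sum_sub_distrib, sub_nonneg]
      calc ∑ i with i.val < k, y (τ i) ≤ kMaxSum (y ∘ τ) k :=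
            sum_le_kMaxSum (y ∘ τ) (by rw [Fin.card_filter_val_lt]; exact min_le_right _ _)
        _ ≤ kMaxSum y k := kMaxSum_comp_equiv_le y τ k
        _ ≤ kMaxSum x k := h k
        _ = kMaxSum ((x ∘ ρ) ∘ ρ.symm) k := by simp [Function.comp_assoc]
        _ ≤ kMaxSum (x ∘ ρ) k := kMaxSum_comp_equiv_le _ _ k
        _ ≤ _ := kMaxSum_le_sum_of_antitone hρ (fun i => hx _) k)
    (t := t) (fun i => ht ⟨i, rfl⟩)
  refine ⟨τ.symm.trans ρ, ?_⟩
  rw [← Equiv.sum_comp τ fun i => c i * y i,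
    ← Equiv.sum_comp τ fun i => c i * x ((τ.symm.trans ρ) i)]
  simpa [mul_sub, sum_sub_distrib, Equiv.sum_comp ρ x, Equiv.sum_comp τ y, hsum] using key

/-- The Hardy–Littlewood–Pólya theorem, for nonnegative vectors. -/
lemma Majorises.exists_mem_doublyStochastic {n : ℕ} {x y : Fin n → ℝ} (hx : ∀ i, 0 ≤ x i)
    (hsum : ∑ i, x i = ∑ i, y i) (h : Majorises x y) :
    ∃ M ∈ doublyStochastic ℝ (Fin n), M *ᵥ x = y := by
  set S : Set (Fin n → ℝ) := Set.range fun σ : Equiv.Perm (Fin n) => x ∘ σ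
  have hS : convexHull ℝ S ⊆ (fun M => M *ᵥ x) '' (doublyStochastic ℝ (Fin n) : Set _) := by
    refine convexHull_min ?_ (convex_doublyStochastic.is_linear_image
      ⟨fun M N => add_mulVec M N x, fun r M => smul_mulVec r M x⟩)
    rintro _ ⟨σ, rfl⟩
    exact ⟨σ.permMatrix ℝ, permMatrix_mem_doublyStochastic, permMatrix_mulVec σ⟩
  refine hS ?_
  by_contra hy
  obtain ⟨f, u, hf, hu⟩ := geometric_hahn_banach_closed_point (convex_convexHull ℝ S)
    ((Set.finite_range _).isClosed_convexHull ℝ) hy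
  have hf_apply (v : Fin n → ℝ) : f v = ∑ i, f (Pi.single i 1) * v i := by
    conv_lhs => rw [pi_eq_sum_univ' v]
    simp [mul_comm]
  obtain ⟨σ, hσ⟩ := exists_perm_sum_mul_le hx hsum h fun i => f (Pi.single i 1)
  have hlt := hf (x ∘ σ) (subset_convexHull ℝ S ⟨σ, rfl⟩)
  rw [hf_apply] at hlt hu
  exact (hσ.trans_lt hlt).not_gt hu

end Majorisation

section Embedding

variable {d D : ℕ} {Dc : Fin d → ℕ} {blk : Fin D → Fin d}

lemma sum_comp_blk (hblk : ∀ i, (Finset.univ.filter fun j => blk j = i).card = Dc i)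
    (f : Fin d → ℝ) : ∑ a, f (blk a) = ∑ i, Dc i * f i := by
  rw [← sum_fiberwise' univ blk f]
  simp [hblk]

lemma sum_embedMap (hDc : ∀ i, 0 < Dc i)
    (hblk : ∀ i, (Finset.univ.filter fun j => blk j = i).card = Dc i) (p : Fin d → ℝ) :
    ∑ a, embedMap Dc blk p a = ∑ i, p i :=
  (sum_comp_blk hblk fun i => p i / Dc i).trans <|
    sum_congr rfl fun i _ => mul_div_cancel₀ _ (by exact_mod_cast (hDc i).ne')

/-- The doubly stochastic matrix on the blown-up space induced by `Λ`. -/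
def liftMatrix (Dc : Fin d → ℕ) (blk : Fin D → Fin d) (Λ : Matrix (Fin d) (Fin d) ℝ) :
    Matrix (Fin D) (Fin D) ℝ :=
  of fun a b => Λ (blk a) (blk b) / Dc (blk a)

lemma liftMatrix_mem_doublyStochastic (hDc : ∀ i, 0 < Dc i)
    (hblk : ∀ i, (Finset.univ.filter fun j => blk j = i).card = Dc i)
    {Λ : Matrix (Fin d) (Fin d) ℝ} (h0 : ∀ i j, 0 ≤ Λ i j) (h1 : ∀ j, ∑ i, Λ i j = 1)
    (hΛ : Λ *ᵥ (fun i => (Dc i : ℝ)) = fun i => (Dc i : ℝ)) :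
    liftMatrix Dc blk Λ ∈ doublyStochastic ℝ (Fin D) := by
  have hne (i) : (Dc i : ℝ) ≠ 0 := by exact_mod_cast (hDc i).ne'
  refine mem_doublyStochastic_iff_sum.2 ⟨fun a b => div_nonneg (h0 _ _) (Nat.cast_nonneg _),
    fun a => ?_, fun b => ?_⟩
  · have hrow := congrFun hΛ (blk a)
    simp only [mulVec, dotProduct] at hrow
    simp only [liftMatrix, of_apply, ← sum_div]
    rw [sum_comp_blk hblk fun j => Λ (blk a) j, div_eq_one_iff_eq (hne _), ← hrow]
    exact sum_congr rfl fun j _ => mul_comm _ _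
  · simp only [liftMatrix, of_apply]
    rw [sum_comp_blk hblk fun i => Λ i (blk b) / Dc i, ← h1 (blk b)]
    exact sum_congr rfl fun i _ => mul_div_cancel₀ _ (hne i)

lemma liftMatrix_mulVec_embedMap (hDc : ∀ i, 0 < Dc i)
    (hblk : ∀ i, (Finset.univ.filter fun j => blk j = i).card = Dc i)
    (Λ : Matrix (Fin d) (Fin d) ℝ) (p : Fin d → ℝ) :
    liftMatrix Dc blk Λ *ᵥ embedMap Dc blk p = embedMap Dc blk (Λ *ᵥ p) := by
  have hne (i) : (Dc i : ℝ) ≠ 0 := by exact_mod_cast (hDc i).ne'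
  ext a
  simp only [liftMatrix, embedMap, mulVec, dotProduct, of_apply]
  rw [sum_comp_blk hblk fun j => Λ (blk a) j / Dc (blk a) * (p j / Dc j), sum_div]
  refine sum_congr rfl fun j _ => ?_
  have := hne j
  field_simp

/-- The matrix obtained by summing `M` over blocks and averaging over each source block. -/
def coarseMatrix (Dc : Fin d → ℕ) (blk : Fin D → Fin d) (M : Matrix (Fin D) (Fin D) ℝ) :
    Matrix (Fin d) (Fin d) ℝ :=
  of fun i j => ∑ a with blk a = i, ∑ b with blk b = j, M a b / Dc j

lemma coarseMatrix_nonneg {M : Matrix (Fin D) (Fin D) ℝ} (hM : ∀ a b, 0 ≤ M a b) (i j : Fin d) :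
    0 ≤ coarseMatrix Dc blk M i j := by
  simp only [coarseMatrix, of_apply]
  exact sum_nonneg fun a _ => sum_nonneg fun b _ => div_nonneg (hM a b) (Nat.cast_nonneg _)

lemma coarseMatrix_mulVec (M : Matrix (Fin D) (Fin D) ℝ) (p : Fin d → ℝ) (i : Fin d) :
    (coarseMatrix Dc blk M *ᵥ p) i = ∑ a with blk a = i, (M *ᵥ embedMap Dc blk p) a := by
  simp only [coarseMatrix, embedMap, mulVec, dotProduct, of_apply, sum_mul]
  rw [sum_comm]
  refine sum_congr rfl fun a _ => ?_
  rw [← sum_fiberwise univ blk]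
  refine sum_congr rfl fun j _ => sum_congr rfl fun b hb => ?_
  rw [(mem_filter.1 hb).2]
  ring

lemma sum_coarseMatrix (hDc : ∀ i, 0 < Dc i)
    (hblk : ∀ i, (Finset.univ.filter fun j => blk j = i).card = Dc i)
    {M : Matrix (Fin D) (Fin D) ℝ} (hM : M ∈ doublyStochastic ℝ (Fin D)) (j : Fin d) :
    ∑ i, coarseMatrix Dc blk M i j = 1 := by
  have hne : (Dc j : ℝ) ≠ 0 := by exact_mod_cast (hDc j).ne'
  simp only [coarseMatrix, of_apply]
  rw [sum_fiberwise, sum_comm]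
  simp [← sum_div, sum_col_of_mem_doublyStochastic hM, hblk, hne]

lemma sum_block_embedMap (hDc : ∀ i, 0 < Dc i)
    (hblk : ∀ i, (Finset.univ.filter fun j => blk j = i).card = Dc i) (q : Fin d → ℝ)
    (i : Fin d) : ∑ a with blk a = i, embedMap Dc blk q a = q i := by
  have hne : (Dc i : ℝ) ≠ 0 := by exact_mod_cast (hDc i).ne'
  rw [sum_congr rfl (g := fun _ => q i / Dc i) fun a ha => by
    rw [embedMap, (mem_filter.1 ha).2]]
  simp [hblk, mul_div_cancel₀ _ hne]

end Embedding

/-- thermodynamic interconversion criterion: there is a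
column-stochastic matrix `Λ` with `Λγ = γ` and `Λp = q` iff `Γp ≻ Γq`. -/
theorem gibbsPreservingStochastic_iff_embedded_majorises
    {d D : ℕ} (Dc : Fin d → ℕ) (hDc : ∀ i, 0 < Dc i) (hD : ∑ i, Dc i = D)
    (blk : Fin D → Fin d)
    (hblk : ∀ i, (Finset.univ.filter fun j => blk j = i).card = Dc i)
    (γ : Fin d → ℝ) (hγ : ∀ i, γ i = (Dc i : ℝ) / (D : ℝ))
    (p q : Fin d → ℝ) (hp : IsProbVec p) (hq : IsProbVec q) :
    (∃ Λ : Matrix (Fin d) (Fin d) ℝ,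
        (∀ i j, 0 ≤ Λ i j) ∧ (∀ j, ∑ i, Λ i j = 1) ∧
        Λ.mulVec γ = γ ∧ Λ.mulVec p = q) ↔
    Majorises (embedMap Dc blk p) (embedMap Dc blk q) := by
  have hne (i) : (Dc i : ℝ) ≠ 0 := by exact_mod_cast (hDc i).ne'
  have hγ_smul : γ = (D : ℝ)⁻¹ • fun i => (Dc i : ℝ) := by
    ext i
    simp [hγ, div_eq_inv_mul]
  have hDne : (D : ℝ)⁻¹ ≠ 0 := by
    obtain ⟨i, hi, -⟩ := exists_ne_zero_of_sum_ne_zero (hp.2.trans_ne one_ne_zero)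
    have : 0 < D := hD ▸ sum_pos (fun i _ => hDc i) ⟨i, hi⟩
    positivity
  constructor
  · rintro ⟨Λ, h0, h1, hΛγ, rfl⟩
    rw [hγ_smul, mulVec_smul] at hΛγ
    rw [← liftMatrix_mulVec_embedMap hDc hblk]
    exact majorises_mulVec_of_mem_doublyStochastic
      (liftMatrix_mem_doublyStochastic hDc hblk h0 h1 (smul_right_injective _ hDne hΛγ)) _
  · intro h
    obtain ⟨M, hM, hMp⟩ := h.exists_mem_doublyStochastic (x := embedMap Dc blk p)
      (fun a => div_nonneg (hp.1 _) (Nat.cast_nonneg _))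
      (by rw [sum_embedMap hDc hblk, sum_embedMap hDc hblk, hp.2, hq.2])
    refine ⟨coarseMatrix Dc blk M, coarseMatrix_nonneg hM.1, sum_coarseMatrix hDc hblk hM, ?_, ?_⟩
    · have hone : embedMap Dc blk (fun i => (Dc i : ℝ)) = 1 := funext fun a => div_self (hne _)
      rw [hγ_smul, mulVec_smul]
      congr 1
      ext i
      rw [coarseMatrix_mulVec, hone, mulVec_one_of_mem_doublyStochastic hM]
      simp [hblk]
    · ext i
      rw [coarseMatrix_mulVec, hMp, sum_block_embedMap hDc hblk]
end
end

section
/- Second-order expansion for distillation: let p and q be probability vectors of dimension d with q flat and D(q) > 0, and let ε ∈ (0,1). Then R*_0(n,ε) = (1/D(q))·[D(p) + √(V(p)/n)·Φ^{-1}(ε)] + o(1/√n) as n → ∞; equivalently, lim_{n→∞} √n·( R*_0(n,ε) − (1/D(q))·[D(p) + √(V(p)/n)·Φ^{-1}(ε)] ) = 0. -/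
open Finset Filter

noncomputable section

/-- The `n`-fold tensor (Kronecker) power of `a`, as a vector indexed by
`Fin n → Fin d` (a probability vector of dimension `d^n`). -/
def tensorPow {d : ℕ} (a : Fin d → ℝ) (n : ℕ) : (Fin n → Fin d) → ℝ :=
  fun f => ∏ j, a (f j)

/-- Shannon entropy `H(p) = -Σ_i p_i log p_i`. -/
def shannonH {ι : Type*} [Fintype ι] (p : ι → ℝ) : ℝ := -∑ i, p i * Real.log (p i)

/-- Entropy variance `V(p) = Σ_i p_i (-log p_i - H(p))²`. -/
def entVar {ι : Type*} [Fintype ι] (p : ι → ℝ) : ℝ :=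
  ∑ i, p i * (-Real.log (p i) - shannonH p) ^ 2

/-- Relative entropy to the uniform distribution: `D(p) = log d - H(p)`. -/
def relD {d : ℕ} (p : Fin d → ℝ) : ℝ := Real.log d - shannonH p

/-- Density of the normal distribution with mean `μ` and variance `v`. -/
def normPDF (μ v x : ℝ) : ℝ :=
  Real.exp (-((x - μ) ^ 2) / (2 * v)) / Real.sqrt (2 * Real.pi * v)

/-- Cumulative distribution function `Φ_{μ,v}` of the normal distribution. -/
def normCDF (μ v x : ℝ) : ℝ := ∫ t in Set.Iic x, normPDF μ v t

/-- The standard normal cumulative distribution function `Φ`. -/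
def Phi (x : ℝ) : ℝ := normCDF 0 1 x

/-- A vector is flat if all of its non-zero entries are equal. -/
def IsFlat {ι : Type*} [Fintype ι] (p : ι → ℝ) : Prop :=
  ∀ i j, p i ≠ 0 → p j ≠ 0 → p i = p j

/-- `P ≻_ε Q`: `P` ε-post-majorises `Q`, i.e. there is a probability vector `Q̃`
with `P ≻ Q̃` and `δ(Q,Q̃) ≤ ε`. -/
def PostMaj {ι κ : Type*} [Fintype ι] [Fintype κ] (ε : ℝ) (P : ι → ℝ) (Q : κ → ℝ) : Prop :=
  ∃ Qt : κ → ℝ, IsProbVec Qt ∧ Majorises P Qt ∧ infid Q Qt ≤ ε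

/-- The inverse of the standard normal cumulative distribution function. -/
def PhiInv (ε : ℝ) : ℝ := Function.invFun Phi ε

/-- A set contains subsets of every smaller size whose mean is at least the mean over the
whole set. -/
lemma exists_subset_card_eq_mul_sum_le {ι : Type*} [DecidableEq ι] (P : ι → ℝ) (T : Finset ι)
    {a : ℕ} (ha : a ≤ T.card) :
    ∃ U ⊆ T, U.card = a ∧ (a : ℝ) * ∑ i ∈ T, P i ≤ T.card * ∑ i ∈ U, P i := by
  induction hk : T.card - a generalizing T with
  | zero => exact ⟨T, Subset.rfl, by lia, by rw [show T.card = a by lia]⟩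
  | succ k ih =>
    have hne : T.Nonempty := by rw [← Finset.card_pos]; lia
    obtain ⟨x, hx, hmin⟩ := T.exists_min_image P hne
    have hcard := Finset.card_erase_of_mem hx
    obtain ⟨U, hU, hUc, hle⟩ := ih (T.erase x) (by lia) (by lia)
    refine ⟨U, hU.trans (T.erase_subset x), hUc, ?_⟩
    have hpos : (0 : ℝ) < T.card := by exact_mod_cast Finset.card_pos.2 hne
    have hsum := Finset.add_sum_erase T P hx
    have hmean : (T.card : ℝ) * P x ≤ ∑ i ∈ T, P i := by
      simpa using Finset.card_nsmul_le_sum T P (P x) hmin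
    have hc : ((T.erase x).card : ℝ) = T.card - 1 := by
      rw [hcard, Nat.cast_sub (by lia)]; simp
    rw [hc] at hle
    rcases Nat.eq_zero_or_pos a with rfl | hapos
    · rw [Finset.card_eq_zero.1 hUc]; simp
    have hc1 : (0 : ℝ) < T.card - 1 := by
      have : (1 : ℝ) < T.card := by exact_mod_cast (by lia : 1 < T.card)
      linarith
    have h1 : ((T.card : ℝ) - 1) * ∑ i ∈ T, P i ≤ T.card * ∑ i ∈ T.erase x, P i := by
      nlinarith
    have ha0 : (0 : ℝ) ≤ a := Nat.cast_nonneg a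
    have h2 := mul_le_mul_of_nonneg_left h1 ha0
    have h3 := mul_le_mul_of_nonneg_left hle hpos.le
    refine le_of_mul_le_mul_left ?_ hc1
    calc ((T.card : ℝ) - 1) * (a * ∑ i ∈ T, P i) = a * ((T.card - 1) * ∑ i ∈ T, P i) := by ring
      _ ≤ a * (T.card * ∑ i ∈ T.erase x, P i) := h2
      _ = T.card * (a * ∑ i ∈ T.erase x, P i) := by ring
      _ ≤ T.card * ((T.card - 1) * ∑ i ∈ U, P i) := h3
      _ = _ := by ring

lemma sum_le_kMaxSum_s12 {ι : Type*} [Fintype ι] (P : ι → ℝ) {k : ℕ} {T : Finset ι}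
    (hT : T.card ≤ k) : ∑ i ∈ T, P i ≤ kMaxSum P k :=
  Finset.le_sup' (fun s => ∑ i ∈ s, P i) (by simpa using hT)

lemma kMaxSum_le_s12 {ι : Type*} [Fintype ι] {P : ι → ℝ} {k : ℕ} {c : ℝ}
    (h : ∀ T : Finset ι, T.card ≤ k → ∑ i ∈ T, P i ≤ c) : kMaxSum P k ≤ c :=
  Finset.sup'_le _ _ fun T hT => h T (by simpa using hT)

lemma exists_sum_eq_kMaxSum {ι : Type*} [Fintype ι] (P : ι → ℝ) (k : ℕ) :
    ∃ T : Finset ι, T.card ≤ k ∧ kMaxSum P k = ∑ i ∈ T, P i := by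
  obtain ⟨T, hT, h⟩ := Finset.exists_mem_eq_sup'
    (⟨∅, by simp⟩ : (Finset.univ.powerset.filter (fun s : Finset ι => s.card ≤ k)).Nonempty)
    (fun s => ∑ i ∈ s, P i)
  exact ⟨T, by simpa using hT, h⟩

/-- Any bijection can be chosen to match two prescribed sets of equal size. -/
lemma exists_equiv_mem_iff {ι κ : Type*} [Fintype ι] [Fintype κ] [DecidableEq ι] [DecidableEq κ]
    (hcard : Fintype.card κ = Fintype.card ι) (S : Finset κ) (T : Finset ι)
    (hST : S.card = T.card) : ∃ e : κ ≃ ι, ∀ x, e x ∈ T ↔ x ∈ S := by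
  have e₁ : {x // x ∈ S} ≃ {x // x ∈ T} := Fintype.equivOfCardEq (by simpa using hST)
  have e₂ : {x // ¬ x ∈ S} ≃ {x // ¬ x ∈ T} := Fintype.equivOfCardEq (by
    rw [Fintype.card_subtype_compl, Fintype.card_subtype_compl]; simp [hST, hcard])
  refine ⟨(Equiv.sumCompl (· ∈ S)).symm.trans
    ((Equiv.sumCongr e₁ e₂).trans (Equiv.sumCompl (· ∈ T))), fun x => ?_⟩
  by_cases hx : x ∈ S
  · simp [Equiv.sumCompl_symm_apply_of_pos, hx]
  · simpa [Equiv.sumCompl_symm_apply_of_neg, hx] using (e₂ ⟨x, hx⟩).2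

/-- Averaging a vector over a set of indices yields a majorised vector. -/
lemma majorises_of_average {ι κ : Type*} [Fintype ι] [Fintype κ] [DecidableEq ι] [DecidableEq κ]
    (P : ι → ℝ) (e : κ ≃ ι) (S : Finset κ) (T : Finset ι) (hT : T.Nonempty)
    (he : ∀ x, e x ∈ T ↔ x ∈ S) :
    Majorises P (fun x => if x ∈ S then (∑ i ∈ T, P i) / T.card else P (e x)) := by
  have hpos : (0 : ℝ) < T.card := by exact_mod_cast Finset.card_pos.2 hT
  have hST : S.card = T.card := Finset.card_bij (fun x _ => e x) (fun x hx => (he x).2 hx)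
    (fun x _ y _ h => e.injective h)
    (fun y hy => ⟨e.symm y, (he _).1 (by simpa using hy), by simp⟩)
  refine fun k => kMaxSum_le_s12 fun U hU => ?_
  rw [Finset.sum_ite, Finset.sum_const, Finset.filter_mem_eq_inter, nsmul_eq_mul]
  obtain ⟨W, hWT, hWc, hW⟩ := exists_subset_card_eq_mul_sum_le P T (a := (U ∩ S).card)
    (hST ▸ Finset.card_le_card Finset.inter_subset_right)
  set U' := U.filter (fun x => x ∉ S)
  have hdisj : Disjoint W (U'.map e.toEmbedding) := by
    rw [Finset.disjoint_left]
    intro y hy hy'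
    obtain ⟨x, hx, rfl⟩ := Finset.mem_map.1 hy'
    exact (Finset.mem_filter.1 hx).2 ((he x).1 (hWT hy))
  have hcard : (W ∪ U'.map e.toEmbedding).card ≤ k := by
    rw [Finset.card_union_of_disjoint hdisj, Finset.card_map, hWc, ← Finset.filter_mem_eq_inter,
      Finset.card_filter_add_card_filter_not]
    exact hU
  refine le_trans ?_ (sum_le_kMaxSum_s12 P hcard)
  rw [Finset.sum_union hdisj, Finset.sum_map]
  refine add_le_add ?_ le_rfl
  rw [mul_div_assoc', div_le_iff₀ hpos, mul_comm (∑ i ∈ W, P i)]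
  exact hW

/-- Post-majorisation of a flat vector only depends on the largest partial sum over its support
size. -/
lemma postMaj_uniform_iff {ι κ : Type*} [Fintype ι] [Fintype κ] [DecidableEq ι] [DecidableEq κ]
    {P : ι → ℝ} (hP : IsProbVec P) (hcard : Fintype.card κ = Fintype.card ι)
    (S : Finset κ) (hS : S.Nonempty) (ε : ℝ) :
    PostMaj ε P (fun x => if x ∈ S then (S.card : ℝ)⁻¹ else 0) ↔
      ∃ T : Finset ι, T.card ≤ S.card ∧ 1 - ε ≤ ∑ i ∈ T, P i := by
  have hpos : (0 : ℝ) < S.card := by exact_mod_cast Finset.card_pos.2 hS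
  have hfid (R : κ → ℝ) : fidelity (fun x => if x ∈ S then (S.card : ℝ)⁻¹ else 0) R =
      (∑ x ∈ S, √((S.card : ℝ)⁻¹ * R x)) ^ 2 := by
    rw [fidelity, ← Finset.sum_subset (Finset.subset_univ S)]
    · congr 1
      exact Finset.sum_congr rfl fun x hx => by simp [hx]
    · intro x _ hx; simp [hx]
  constructor
  · rintro ⟨R, hR, hmaj, hinf⟩
    obtain ⟨T, hT, hTs⟩ := exists_sum_eq_kMaxSum P S.card
    refine ⟨T, hT, ?_⟩
    rw [← hTs]
    refine le_trans ?_ ((sum_le_kMaxSum_s12 R le_rfl).trans (hmaj S.card))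
    rw [infid, hfid] at hinf
    have hcs := Finset.sum_mul_sq_le_sq_mul_sq S (fun _ => √((S.card : ℝ)⁻¹)) (fun x => √(R x))
    simp only [Real.sq_sqrt (inv_nonneg.2 hpos.le), Real.sq_sqrt (hR.1 _), Finset.sum_const,
      nsmul_eq_mul, mul_inv_cancel₀ hpos.ne', one_mul,
      ← Real.sqrt_mul (inv_nonneg.2 hpos.le)] at hcs
    linarith
  · rintro ⟨T₀, hT₀, hT₀s⟩
    obtain ⟨T, hT₀T, -, hTc⟩ := Finset.exists_subsuperset_card_eq (Finset.subset_univ T₀) hT₀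
      (by rw [Finset.card_univ, ← hcard]; exact Finset.card_le_univ S)
    have hTs : 1 - ε ≤ ∑ i ∈ T, P i := hT₀s.trans
      (Finset.sum_le_sum_of_subset_of_nonneg hT₀T fun i _ _ => hP.1 i)
    obtain ⟨e, he⟩ := exists_equiv_mem_iff hcard S T hTc.symm
    have hsum0 : 0 ≤ ∑ i ∈ T, P i := Finset.sum_nonneg fun i _ => hP.1 i
    refine ⟨fun x => if x ∈ S then (∑ i ∈ T, P i) / T.card else P (e x), ⟨fun x => ?_, ?_⟩,
      majorises_of_average P e S T (by rw [← Finset.card_pos, hTc]; exact Finset.card_pos.2 hS) he,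
      ?_⟩
    · dsimp only
      split_ifs
      · positivity
      · exact hP.1 _
    · rw [Finset.sum_ite, Finset.sum_const, Finset.filter_mem_eq_inter, Finset.univ_inter,
        nsmul_eq_mul, hTc, mul_div_cancel₀ _ hpos.ne', ← hP.2, ← Equiv.sum_comp e]
      have : ∑ i ∈ T, P i = ∑ x ∈ univ.filter (fun x => x ∈ S), P (e x) := by
        refine Finset.sum_bij' (fun i _ => e.symm i) (fun x _ => e x) ?_ ?_ ?_ ?_ ?_
        · intro i hi; simpa using (he _).1 (by simpa using hi)
        · intro x hx; exact (he x).2 (by simpa using hx)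
        · simp
        · simp
        · simp
      rw [this, Finset.sum_filter_add_sum_filter_not]
    · rw [infid, hfid]
      have : ∑ x ∈ S, √((S.card : ℝ)⁻¹ * (if x ∈ S then (∑ i ∈ T, P i) / T.card else P (e x))) =
          √(∑ i ∈ T, P i) := by
        rw [Finset.sum_congr rfl (g := fun _ => √(∑ i ∈ T, P i) / S.card)]
        · rw [Finset.sum_const, nsmul_eq_mul, mul_div_cancel₀ _ hpos.ne']
        · intro x hx
          rw [if_pos hx, hTc, show (S.card : ℝ)⁻¹ * ((∑ i ∈ T, P i) / S.card) =
            (∑ i ∈ T, P i) / (S.card : ℝ) ^ 2 by field_simp, Real.sqrt_div hsum0,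
            Real.sqrt_sq hpos.le]
      rw [this, Real.sq_sqrt hsum0]
      linarith

lemma IsProbVec.tensorPow {d : ℕ} {a : Fin d → ℝ} (ha : IsProbVec a) (n : ℕ) :
    IsProbVec (tensorPow a n) := by
  refine ⟨fun f => Finset.prod_nonneg fun j _ => ha.1 _, ?_⟩
  have h := Finset.prod_univ_sum (fun _ : Fin n => (univ : Finset (Fin d))) (fun _ i => a i)
  simpa [ha.2, _root_.tensorPow] using h.symm

lemma IsProbVec.mul_prod {ι κ : Type*} [Fintype ι] [Fintype κ] {a : ι → ℝ} {b : κ → ℝ}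
    (ha : IsProbVec a) (hb : IsProbVec b) : IsProbVec (fun x : ι × κ => a x.1 * b x.2) := by
  refine ⟨fun x => mul_nonneg (ha.1 _) (hb.1 _), ?_⟩
  rw [Fintype.sum_prod_type, ← Fintype.sum_mul_sum, ha.2, hb.2, one_mul]

lemma IsProbVec.dim_pos {d : ℕ} {a : Fin d → ℝ} (ha : IsProbVec a) : 0 < d := by
  rcases Nat.eq_zero_or_pos d with rfl | h
  · simpa using ha.2
  · exact h

lemma isProbVec_uniform {d : ℕ} (hd : 0 < d) : IsProbVec (fun _ : Fin d => (d : ℝ)⁻¹) := by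
  refine ⟨fun _ => by positivity, ?_⟩
  have : (d : ℝ) ≠ 0 := by positivity
  simp [this]

lemma tensorPow_const {d : ℕ} (c : ℝ) (n : ℕ) (f : Fin n → Fin d) :
    tensorPow (fun _ => c) n f = c ^ n := by
  simp [tensorPow]

lemma tensorPow_eq_exp {d : ℕ} {p : Fin d → ℝ} {n : ℕ} {f : Fin n → Fin d}
    (hp : ∀ i, 0 ≤ p i) (hf : tensorPow p n f ≠ 0) :
    tensorPow p n f = Real.exp (-∑ j, -Real.log (p (f j))) := by
  rw [Finset.sum_neg_distrib, neg_neg, Real.exp_sum]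
  refine Finset.prod_congr rfl fun j hj => (Real.exp_log ?_).symm
  exact (hp _).lt_of_ne' (Finset.prod_ne_zero_iff.1 hf j hj)

/-- The distribution function of the sum of `n` independent copies of `-log p`. -/
def surprisalCDF {d : ℕ} (p : Fin d → ℝ) (n : ℕ) (t : ℝ) : ℝ :=
  ∑ f : Fin n → Fin d with ∑ j, -Real.log (p (f j)) ≤ t, tensorPow p n f

lemma IsFlat.eq_inv_card {ι : Type*} [Fintype ι] {q : ι → ℝ} (hq : IsProbVec q)
    (hf : IsFlat q) {i : ι} (hi : q i ≠ 0) : q i = ((#{j | q j ≠ 0} : ℕ) : ℝ)⁻¹ := by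
  have h : ∑ j, q j = #{j | q j ≠ 0} * q i := by
    rw [← Finset.sum_filter_ne_zero, ← nsmul_eq_mul]
    exact Finset.sum_eq_card_nsmul fun j hj => hf j i (Finset.mem_filter.1 hj).2 hi
  rw [hq.2] at h
  exact eq_inv_of_mul_eq_one_right h.symm

lemma IsProbVec.card_support_pos {ι : Type*} [Fintype ι] {q : ι → ℝ} (hq : IsProbVec q) :
    0 < #{j | q j ≠ 0} := by
  rw [Finset.card_pos]
  by_contra h
  rw [Finset.not_nonempty_iff_eq_empty] at h
  have := hq.2
  rw [← Finset.sum_filter_ne_zero, h] at this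
  simp at this

lemma IsFlat.shannonH_eq {ι : Type*} [Fintype ι] {q : ι → ℝ} (hq : IsProbVec q)
    (hf : IsFlat q) : shannonH q = Real.log (#{j | q j ≠ 0} : ℕ) := by
  have h (i : ι) : q i * Real.log (q i) = q i * -Real.log (#{j | q j ≠ 0} : ℕ) := by
    by_cases hi : q i = 0
    · simp [hi]
    · rw [← Real.log_inv, ← hf.eq_inv_card hq hi]
  rw [shannonH, Finset.sum_congr rfl fun i _ => h i, ← Finset.sum_mul, hq.2]
  ring

section Distillation

variable {d : ℕ} {p q : Fin d → ℝ} {n m : ℕ} {ε γ : ℝ}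

/-- The support of `q^{⊗m} ⊗ η^{⊗n}`. -/
def targetSupport (q : Fin d → ℝ) (m n : ℕ) : Finset ((Fin m → Fin d) × (Fin n → Fin d)) :=
  Fintype.piFinset (fun _ => univ.filter (fun j => q j ≠ 0)) ×ˢ univ

lemma card_targetSupport (q : Fin d → ℝ) (m n : ℕ) :
    (targetSupport q m n).card = #{j | q j ≠ 0} ^ m * d ^ n := by
  simp [targetSupport, Finset.card_product]

lemma target_eq (hq : IsProbVec q) (hf : IsFlat q) :
    (fun fg : (Fin m → Fin d) × (Fin n → Fin d) =>
      tensorPow q m fg.1 * tensorPow (fun _ : Fin d => (d : ℝ)⁻¹) n fg.2) =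
    fun x => if x ∈ targetSupport q m n then ((targetSupport q m n).card : ℝ)⁻¹ else 0 := by
  ext ⟨f, g⟩
  rw [card_targetSupport, tensorPow_const]
  split_ifs with h
  · have h' : ∀ j, q (f j) ≠ 0 := by simpa [targetSupport] using h
    simp only [tensorPow, fun j => hf.eq_inv_card hq (h' j)]
    simp [mul_comm]
  · have h' : ∃ j, q (f j) = 0 := by simpa [targetSupport] using h
    obtain ⟨j, hj⟩ := h'
    rw [tensorPow, Finset.prod_eq_zero (Finset.mem_univ j) hj, zero_mul]

lemma exp_threshold (hq : IsProbVec q) (hf : IsFlat q) :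
    Real.exp (n * Real.log d - m * relD q) = (targetSupport q m n).card / (d : ℝ) ^ m := by
  have hd : (0 : ℝ) < d := by exact_mod_cast hq.dim_pos
  have hr : (0 : ℝ) < (#{j | q j ≠ 0} : ℕ) := by exact_mod_cast hq.card_support_pos
  rw [card_targetSupport, relD, hf.shannonH_eq hq,
    show n * Real.log d - m * (Real.log d - Real.log (#{j | q j ≠ 0} : ℕ)) =
      m * Real.log (#{j | q j ≠ 0} : ℕ) + n * Real.log d - m * Real.log d by ring,
    Real.exp_sub, Real.exp_add, Real.exp_nat_mul, Real.exp_nat_mul, Real.exp_nat_mul,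
    Real.exp_log hd, Real.exp_log hr]
  push_cast
  rfl

lemma sum_source_filter (hd : 0 < d) (s : Finset (Fin n → Fin d)) :
    ∑ fg ∈ s ×ˢ (univ : Finset (Fin m → Fin d)),
      tensorPow p n fg.1 * tensorPow (fun _ : Fin d => (d : ℝ)⁻¹) m fg.2 =
    ∑ f ∈ s, tensorPow p n f := by
  rw [Finset.sum_product, ← Finset.sum_mul_sum, ((isProbVec_uniform hd).tensorPow m).2, mul_one]

/-- The resource conversions in the definition of the optimal rate. -/
def Convertible (p q : Fin d → ℝ) (ε : ℝ) (n m : ℕ) : Prop :=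
  PostMaj ε
    (fun fg : (Fin n → Fin d) × (Fin m → Fin d) =>
      tensorPow p n fg.1 * tensorPow (fun _ : Fin d => (d : ℝ)⁻¹) m fg.2)
    (fun fg : (Fin m → Fin d) × (Fin n → Fin d) =>
      tensorPow q m fg.1 * tensorPow (fun _ : Fin d => (d : ℝ)⁻¹) n fg.2)

lemma convertible_iff (hp : IsProbVec p) (hq : IsProbVec q) (hf : IsFlat q) :
    Convertible p q ε n m ↔ ∃ T : Finset ((Fin n → Fin d) × (Fin m → Fin d)),
      T.card ≤ (targetSupport q m n).card ∧ 1 - ε ≤ ∑ fg ∈ T,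
        tensorPow p n fg.1 * tensorPow (fun _ : Fin d => (d : ℝ)⁻¹) m fg.2 := by
  rw [Convertible, target_eq hq hf]
  refine postMaj_uniform_iff ((hp.tensorPow n).mul_prod
    ((isProbVec_uniform hp.dim_pos).tensorPow m)) (by simp [mul_comm]) _ ?_ ε
  rw [← Finset.card_pos, card_targetSupport]
  exact Nat.mul_pos (Nat.pow_pos hq.card_support_pos) (Nat.pow_pos hq.dim_pos)

lemma convertible_of_le_surprisalCDF (hp : IsProbVec p) (hq : IsProbVec q) (hf : IsFlat q)
    (h : 1 - ε ≤ surprisalCDF p n (n * Real.log d - m * relD q)) : Convertible p q ε n m := by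
  have hd : (0 : ℝ) < d := by exact_mod_cast hp.dim_pos
  rw [convertible_iff hp hq hf]
  set s := univ.filter (fun f : Fin n → Fin d =>
    ∑ j, -Real.log (p (f j)) ≤ n * Real.log d - m * relD q)
  set s' := s.filter (fun f => tensorPow p n f ≠ 0)
  have hs' : ∑ f ∈ s', tensorPow p n f = surprisalCDF p n (n * Real.log d - m * relD q) :=
    Finset.sum_filter_ne_zero s
  refine ⟨s' ×ˢ univ, ?_, by rwa [sum_source_filter hp.dim_pos, hs']⟩
  have hexp := exp_threshold (n := n) (m := m) hq hf
  set K : ℝ := ((targetSupport q m n).card : ℝ)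
  have hKpos : 0 < K / (d : ℝ) ^ m := hexp ▸ Real.exp_pos _
  have hlow : ∀ f ∈ s', (K / (d : ℝ) ^ m)⁻¹ ≤ tensorPow p n f := by
    intro f hfs
    obtain ⟨h1, h2⟩ := Finset.mem_filter.1 hfs
    rw [tensorPow_eq_exp hp.1 h2, ← hexp, ← Real.exp_neg]
    exact Real.exp_le_exp.2 (neg_le_neg (Finset.mem_filter.1 h1).2)
  have hsum : (s'.card : ℝ) * (K / (d : ℝ) ^ m)⁻¹ ≤ 1 := by
    rw [← (hp.tensorPow n).2, ← nsmul_eq_mul]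
    exact (Finset.card_nsmul_le_sum _ _ _ hlow).trans
      (Finset.sum_le_sum_of_subset_of_nonneg (Finset.subset_univ _)
        fun f _ _ => (hp.tensorPow n).1 f)
  rw [← div_eq_mul_inv, div_le_one hKpos, le_div_iff₀ (by positivity)] at hsum
  have : ((s' ×ˢ (univ : Finset (Fin m → Fin d))).card : ℝ) ≤ K := by
    simpa [Finset.card_product] using hsum
  exact Nat.cast_le.1 this

lemma Convertible.le_surprisalCDF_add (hp : IsProbVec p) (hq : IsProbVec q) (hf : IsFlat q)
    (h : Convertible p q ε n m) :
    1 - ε ≤ surprisalCDF p n (n * Real.log d - m * relD q + γ) + Real.exp (-γ) := by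
  have hd : (0 : ℝ) < d := by exact_mod_cast hp.dim_pos
  rw [convertible_iff hp hq hf] at h
  obtain ⟨T, hT, hTs⟩ := h
  refine hTs.trans ?_
  have hexp := exp_threshold (n := n) (m := m) hq hf
  set t := n * Real.log d - m * relD q
  have hKT : (T.card : ℝ) ≤ (targetSupport q m n).card := Nat.cast_le.2 hT
  set K : ℝ := ((targetSupport q m n).card : ℝ)
  have hKpos : 0 < K / (d : ℝ) ^ m := hexp ▸ Real.exp_pos _
  have hP := (hp.tensorPow n).mul_prod ((isProbVec_uniform hp.dim_pos).tensorPow m)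
  have hK : 0 < K := (div_pos_iff_of_pos_right (by positivity)).1 hKpos
  rw [← Finset.sum_filter_add_sum_filter_not T
    (fun fg => ∑ j, -Real.log (p (fg.1 j)) ≤ t + γ)]
  refine add_le_add ?_ ?_
  · rw [surprisalCDF, ← sum_source_filter (m := m) hp.dim_pos]
    refine Finset.sum_le_sum_of_subset_of_nonneg (fun fg hfg => ?_) fun fg _ _ => hP.1 fg
    simpa using (Finset.mem_filter.1 hfg).2
  · have hb : ∀ fg ∈ T.filter (fun fg => ¬ ∑ j, -Real.log (p (fg.1 j)) ≤ t + γ),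
        tensorPow p n fg.1 * tensorPow (fun _ : Fin d => (d : ℝ)⁻¹) m fg.2 ≤
          Real.exp (-γ) / K := by
      intro fg hfg
      by_cases h0 : tensorPow p n fg.1 = 0
      · rw [h0, zero_mul]; positivity
      rw [tensorPow_eq_exp hp.1 h0, tensorPow_const]
      have hlt := not_le.1 (Finset.mem_filter.1 hfg).2
      have : Real.exp (-γ) / K = Real.exp (-(t + γ)) * (d : ℝ)⁻¹ ^ m := by
        rw [neg_add, Real.exp_add, Real.exp_neg t, hexp, inv_pow]
        field_simp
      rw [this]
      gcongr
    refine (Finset.sum_le_card_nsmul _ _ _ hb).trans ?_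
    rw [nsmul_eq_mul, mul_div_assoc', div_le_iff₀ hK, mul_comm]
    have : ((T.filter (fun fg => ¬ ∑ j, -Real.log (p (fg.1 j)) ≤ t + γ)).card : ℝ) ≤ K :=
      le_trans (by exact_mod_cast Finset.card_filter_le _ _) hKT
    gcongr

end Distillation

section CentralLimit

open MeasureTheory ProbabilityTheory Topology

/-- The probability measure on a finite set with the given weights. -/
def weightMeasure {ι : Type*} [Fintype ι] [MeasurableSpace ι] (p : ι → ℝ) : Measure ι :=
  ∑ i, ENNReal.ofReal (p i) • Measure.dirac i

section WeightMeasure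

variable {ι : Type*} [Fintype ι] [MeasurableSpace ι] {p : ι → ℝ}

lemma isProbabilityMeasure_weightMeasure (hp : IsProbVec p) :
    IsProbabilityMeasure (weightMeasure p) := by
  refine ⟨?_⟩
  simp only [weightMeasure, Measure.coe_finsetSum, Finset.sum_apply, Measure.smul_apply,
    measure_univ, smul_eq_mul, mul_one]
  rw [← ENNReal.ofReal_sum_of_nonneg fun i _ => hp.1 i, hp.2, ENNReal.ofReal_one]

variable [MeasurableSingletonClass ι]

lemma weightMeasure_singleton (p : ι → ℝ) (i : ι) :
    weightMeasure p {i} = ENNReal.ofReal (p i) := by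
  classical
  simp only [weightMeasure, Measure.coe_finsetSum, Finset.sum_apply, Measure.smul_apply,
    smul_eq_mul, Measure.dirac_apply, Set.indicator_apply, Set.mem_singleton_iff, Pi.one_apply]
  simp

lemma integral_weightMeasure (hp : IsProbVec p) (g : ι → ℝ) :
    ∫ i, g i ∂(weightMeasure p) = ∑ i, p i * g i := by
  have := isProbabilityMeasure_weightMeasure hp
  rw [integral_fintype Integrable.of_finite]
  refine Finset.sum_congr rfl fun i _ => ?_
  rw [measureReal_def, weightMeasure_singleton, ENNReal.toReal_ofReal (hp.1 i), smul_eq_mul]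

end WeightMeasure

variable {d : ℕ} {p : Fin d → ℝ}

/-- The law of an infinite sequence of independent samples from `p`. -/
def iidMeasure (p : Fin d → ℝ) : Measure (ℕ → Fin d) :=
  Measure.infinitePi fun _ => weightMeasure p

lemma iidMeasure_real_eq (hp : IsProbVec p) (n : ℕ) (t : ℝ) :
    (iidMeasure p).real {ω | ∑ k ∈ Finset.range n, -Real.log (p (ω k)) ≤ t} =
      surprisalCDF p n t := by
  have := isProbabilityMeasure_weightMeasure hp
  have hmap := Measure.map_infinitePi_infinitePi_of_inj (P := fun _ : ℕ => weightMeasure p)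
    (f := fun j : Fin n => (j : ℕ)) Fin.val_injective
  have hset : {ω : ℕ → Fin d | ∑ k ∈ Finset.range n, -Real.log (p (ω k)) ≤ t} =
      (fun (ω : ℕ → Fin d) (j : Fin n) => ω j) ⁻¹'
        {f | ∑ j, -Real.log (p (f j)) ≤ t} := by
    ext ω
    simp only [Set.mem_ofPred_eq, Set.mem_preimage]
    rw [Finset.sum_range (fun k => -Real.log (p (ω k)))]
  rw [hset, iidMeasure, ← map_measureReal_apply (by fun_prop) (Set.toFinite _).measurableSet, hmap,
    surprisalCDF]
  have hcoe : {f : Fin n → Fin d | ∑ j, -Real.log (p (f j)) ≤ t} =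
      ((univ.filter (fun f : Fin n → Fin d => ∑ j, -Real.log (p (f j)) ≤ t) : Finset _) :
        Set (Fin n → Fin d)) := by ext; simp
  rw [hcoe, ← sum_measureReal_singleton]
  refine Finset.sum_congr rfl fun f _ => ?_
  rw [measureReal_def, Measure.infinitePi_singleton_of_fintype, ENNReal.toReal_prod]
  refine Finset.prod_congr rfl fun j _ => ?_
  rw [weightMeasure_singleton, ENNReal.toReal_ofReal (hp.1 _)]

lemma tendsto_surprisalCDF (hp : IsProbVec p) {y : ℝ}
    (hy : gaussianReal 0 (entVar p).toNNReal {y} = 0) :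
    Tendsto (fun n : ℕ => surprisalCDF p n (n * shannonH p + √n * y)) atTop
      (𝓝 ((gaussianReal 0 (entVar p).toNNReal).real (Set.Iic y))) := by
  have := isProbabilityMeasure_weightMeasure hp
  have : IsProbabilityMeasure (iidMeasure p) := by unfold iidMeasure; infer_instance
  set X : ℕ → (ℕ → Fin d) → ℝ := fun k ω => -Real.log (p (ω k))
  have heval (k : ℕ) := measurePreserving_eval_infinitePi (fun _ : ℕ => weightMeasure p) k
  have hg : Measurable fun i : Fin d => -Real.log (p i) := measurable_from_top
  have hXm (k : ℕ) : Measurable (X k) := hg.comp (measurable_pi_apply k)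
  have hindep : iIndepFun X (iidMeasure p) := iIndepFun_infinitePi (fun _ => hg)
  have hident (k : ℕ) : IdentDistrib (X k) (X 0) (iidMeasure p) (iidMeasure p) := by
    have h : IdentDistrib (fun ω : ℕ → Fin d => ω k) (fun ω => ω 0)
        (iidMeasure p) (iidMeasure p) :=
      ⟨(measurable_pi_apply _).aemeasurable, (measurable_pi_apply _).aemeasurable,
        (heval k).map_eq.trans (heval 0).map_eq.symm⟩
    exact h.comp hg
  have hexpect (g : Fin d → ℝ) : ∫ ω, g (ω 0) ∂(iidMeasure p) = ∑ i, p i * g i := by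
    rw [← integral_weightMeasure hp, ← (heval 0).map_eq, integral_map
      (measurable_pi_apply _).aemeasurable (measurable_from_top.aestronglyMeasurable)]
    rfl
  have hmean : (iidMeasure p)[X 0] = shannonH p := by
    rw [hexpect fun i => -Real.log (p i)]
    simp [shannonH]
  have hvar : Var[X 0; iidMeasure p] = entVar p := by
    rw [variance_eq_integral (hXm 0).aemeasurable, hmean,
      hexpect fun i => (-Real.log (p i) - shannonH p) ^ 2, entVar]
  have hLp : MemLp (X 0) 2 (iidMeasure p) := by
    refine MemLp.of_bound (hXm 0).aestronglyMeasurable (∑ i, ‖-Real.log (p i)‖)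
      (Eventually.of_forall fun ω => ?_)
    exact Finset.single_le_sum (f := fun i => ‖-Real.log (p i)‖) (fun i _ => norm_nonneg _)
      (Finset.mem_univ (ω 0))
  have hclt := tendstoInDistribution_inv_sqrt_mul_sum_sub
    (Y := id) (P' := gaussianReal 0 Var[X 0; iidMeasure p].toNNReal) HasLaw.id hLp hindep hident
  have hlim := ProbabilityMeasure.tendsto_measure_of_null_frontier_of_tendsto hclt.tendsto
    (E := Set.Iic y) (by
      rw [frontier_Iic, ProbabilityMeasure.mk_apply]
      simp [hvar, hy])
  have hlim' := NNReal.tendsto_coe.2 hlim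
  simp only [ProbabilityMeasure.mk_apply, Measure.map_id, hvar, hmean] at hlim'
  refine (hlim'.congr' ?_)
  filter_upwards [eventually_gt_atTop 0] with n hn
  have hn' : 0 < √(n : ℝ) := Real.sqrt_pos.2 (by exact_mod_cast hn)
  rw [← iidMeasure_real_eq hp, measureReal_def, Measure.map_apply
    (by fun_prop) measurableSet_Iic]
  change ENNReal.toReal _ = _
  congr 2
  ext ω
  simp only [Set.mem_preimage, Set.mem_Iic, Set.mem_ofPred_eq, X]
  rw [inv_mul_le_iff₀ hn', sub_le_iff_le_add, add_comm]

end CentralLimit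

lemma surprisalCDF_mono {d : ℕ} {p : Fin d → ℝ} (hp : IsProbVec p) (n : ℕ) :
    Monotone (surprisalCDF p n) := by
  intro s t hst
  refine Finset.sum_le_sum_of_subset_of_nonneg (fun f hf => ?_)
    fun f _ _ => (hp.tensorPow n).1 f
  simp only [Finset.mem_filter, Finset.mem_univ, true_and] at hf ⊢
  exact hf.trans hst

section Gaussian

open MeasureTheory ProbabilityTheory Topology

lemma Phi_eq_gaussianReal (x : ℝ) : Phi x = (gaussianReal 0 1).real (Set.Iic x) := by
  rw [measureReal_def, gaussianReal_apply_eq_integral 0 one_ne_zero, ENNReal.toReal_ofReal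
    (integral_nonneg fun y => gaussianPDFReal_nonneg _ _ _), Phi, normCDF]
  refine integral_congr_ae (Eventually.of_forall fun y => ?_)
  simp [normPDF, gaussianPDFReal, div_eq_inv_mul]

lemma gaussianReal_singleton_of_ne_zero {v : NNReal} (hv : v ≠ 0) (x : ℝ) :
    gaussianReal 0 v {x} = 0 :=
  gaussianReal_absolutelyContinuous 0 hv (by simp)

lemma continuous_Phi : Continuous Phi := by
  have h : Phi = fun x => ∫ t in Set.Iic x, gaussianPDFReal 0 1 t := by
    ext x
    rw [Phi, normCDF]
    refine integral_congr_ae (Eventually.of_forall fun y => ?_)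
    simp [normPDF, gaussianPDFReal, div_eq_inv_mul]
  have hi := integrable_gaussianPDFReal 0 1
  have h' : Phi = fun x => (∫ t in Set.Iic 0, gaussianPDFReal 0 1 t) +
      ∫ t in (0 : ℝ)..x, gaussianPDFReal 0 1 t := by
    ext x
    rw [h, ← intervalIntegral.integral_Iic_sub_Iic hi.integrableOn hi.integrableOn]
    ring
  rw [h']
  exact continuous_const.add (intervalIntegral.continuous_primitive
    (fun a b => hi.intervalIntegrable) 0)

lemma Phi_PhiInv {ε : ℝ} (hε : ε ∈ Set.Ioo (0 : ℝ) 1) : Phi (PhiInv ε) = ε := by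
  have hcdf : ⇑(cdf (gaussianReal 0 1)) = Phi := by
    ext x; rw [cdf_eq_real, Phi_eq_gaussianReal]
  have h0 := tendsto_cdf_atBot (gaussianReal 0 1)
  have h1 := tendsto_cdf_atTop (gaussianReal 0 1)
  rw [hcdf] at h0 h1
  refine Function.invFun_eq (f := Phi) ?_
  obtain ⟨a, ha⟩ := (h0.eventually (gt_mem_nhds hε.1)).exists
  obtain ⟨b, hb⟩ := (h1.eventually (lt_mem_nhds hε.2)).exists
  exact mem_range_of_exists_le_of_exists_ge continuous_Phi ⟨a, ha.le⟩ ⟨b, hb.le⟩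

lemma strictMono_Phi : StrictMono Phi := by
  intro a b hab
  rw [Phi_eq_gaussianReal, Phi_eq_gaussianReal, ← Set.Iic_union_Ioc_eq_Iic hab.le,
    measureReal_union ((Set.Iic_disjoint_Ioc le_rfl)) measurableSet_Ioc]
  refine lt_add_of_pos_right _ (ENNReal.toReal_pos (fun h => ?_) (measure_ne_top _ _))
  have := gaussianReal_absolutelyContinuous' 0 one_ne_zero h
  rw [Real.volume_Ioc, ENNReal.ofReal_eq_zero] at this
  linarith

lemma Phi_neg (x : ℝ) : Phi (-x) = 1 - Phi x := by
  have h := gaussianReal_map_neg (μ := 0) (v := 1)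
  rw [neg_zero] at h
  have hpre : (fun y : ℝ => -y) ⁻¹' Set.Iic (-x) = Set.Ici x := by
    ext y; simp
  have hatom := nullSingletonClass_gaussianReal (μ := 0) one_ne_zero
  calc Phi (-x) = ((gaussianReal 0 1).map fun y => -y).real (Set.Iic (-x)) := by
        rw [h, Phi_eq_gaussianReal]
    _ = (gaussianReal 0 1).real (Set.Ici x) := by
        rw [map_measureReal_apply (by fun_prop) measurableSet_Iic, hpre]
    _ = (gaussianReal 0 1).real (Set.Iic x)ᶜ := by
        rw [Set.compl_Iic]
        exact measureReal_congr Ioi_ae_eq_Ici.symm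
    _ = 1 - Phi x := by
        rw [probReal_compl_eq_one_sub measurableSet_Iic, Phi_eq_gaussianReal]

lemma gaussianReal_real_Iic {V : ℝ} (hV : 0 < V) (y : ℝ) :
    (gaussianReal 0 V.toNNReal).real (Set.Iic y) = Phi (y / √V) := by
  have h := gaussianReal_map_const_mul (μ := 0) (v := 1) (√V)
  have hv : NNReal.mk (√V ^ 2) (sq_nonneg _) * 1 = V.toNNReal := by
    ext; simp [Real.sq_sqrt hV.le, hV.le]
  rw [mul_zero, hv] at h
  rw [← h, map_measureReal_apply (by fun_prop) measurableSet_Iic, Phi_eq_gaussianReal]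
  congr 1
  ext x
  simp only [Set.mem_preimage, Set.mem_Iic]
  rw [le_div_iff₀' (Real.sqrt_pos.2 hV)]

variable {V ε δ : ℝ}

lemma gaussianReal_singleton_eq_zero (hV : 0 ≤ V) (z : ℝ) (hδ : δ ≠ 0) :
    gaussianReal 0 V.toNNReal {√V * z + δ} = 0 := by
  rcases hV.eq_or_lt with rfl | hV
  · simp [gaussianReal_zero_var, hδ.symm]
  · exact gaussianReal_singleton_of_ne_zero (by simpa using hV) _

lemma lt_gaussianReal_real_Iic (hε : ε ∈ Set.Ioo (0 : ℝ) 1) (hV : 0 ≤ V) (hδ : 0 < δ) :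
    1 - ε < (gaussianReal 0 V.toNNReal).real (Set.Iic (√V * -PhiInv ε + δ)) := by
  rcases hV.eq_or_lt with rfl | hV
  · simp [gaussianReal_zero_var, measureReal_def, hδ.le, hε.1]
  · have hs := Real.sqrt_pos.2 hV
    rw [gaussianReal_real_Iic hV, ← Phi_PhiInv hε, ← Phi_neg, Phi_PhiInv hε]
    refine strictMono_Phi ?_
    rw [lt_div_iff₀' hs]
    linarith

lemma gaussianReal_real_Iic_lt (hε : ε ∈ Set.Ioo (0 : ℝ) 1) (hV : 0 ≤ V) (hδ : 0 < δ) :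
    (gaussianReal 0 V.toNNReal).real (Set.Iic (√V * -PhiInv ε + -δ)) < 1 - ε := by
  rcases hV.eq_or_lt with rfl | hV
  · simp [gaussianReal_zero_var, measureReal_def, hδ, hε.2]
  · have hs := Real.sqrt_pos.2 hV
    rw [gaussianReal_real_Iic hV, ← Phi_PhiInv hε, ← Phi_neg, Phi_PhiInv hε]
    refine strictMono_Phi ?_
    rw [div_lt_iff₀' hs]
    linarith

end Gaussian

lemma entVar_nonneg {ι : Type*} [Fintype ι] {p : ι → ℝ} (hp : IsProbVec p) : 0 ≤ entVar p :=
  Finset.sum_nonneg fun i _ => mul_nonneg (hp.1 i) (sq_nonneg _)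

lemma convertible_zero {d : ℕ} {p q : Fin d → ℝ} {n : ℕ} {ε : ℝ} (hp : IsProbVec p)
    (hq : IsProbVec q) (hf : IsFlat q) (hε : 0 ≤ ε) : Convertible p q ε n 0 := by
  rw [convertible_iff hp hq hf]
  refine ⟨univ, by simp [card_targetSupport, Fintype.card_pi], ?_⟩
  rw [((hp.tensorPow n).mul_prod ((isProbVec_uniform hp.dim_pos).tensorPow 0)).2]
  linarith

/-- The largest convertible number of copies is pinned down to within `o(√n)`. -/
lemma eventually_abs_sSup_convertible_le {d : ℕ} {p q : Fin d → ℝ} (hp : IsProbVec p)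
    (hq : IsProbVec q) (hf : IsFlat q) (hDq : 0 < relD q) {ε : ℝ}
    (hε : ε ∈ Set.Ioo (0 : ℝ) 1) {δ : ℝ} (hδ : 0 < δ) :
    ∀ᶠ n : ℕ in atTop, |((sSup {m : ℕ | Convertible p q ε n m} : ℕ) : ℝ) * relD q -
      (n * relD p + √n * (√(entVar p) * PhiInv ε))| ≤ 2 * δ * √n := by
  have hV := entVar_nonneg hp
  have hsqrt : Tendsto (fun n : ℕ => √(n : ℝ) * δ) atTop atTop :=
    (Real.tendsto_sqrt_atTop.comp tendsto_natCast_atTop_atTop).atTop_mul_const hδ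
  have hlow := (tendsto_surprisalCDF hp
    (gaussianReal_singleton_eq_zero hV (-PhiInv ε) hδ.ne')).eventually
      (lt_mem_nhds (lt_gaussianReal_real_Iic hε hV hδ))
  have hup := ((tendsto_surprisalCDF hp
    (gaussianReal_singleton_eq_zero hV (-PhiInv ε) (neg_ne_zero.2 hδ.ne'))).add
      (Real.tendsto_exp_neg_atTop_nhds_zero.comp hsqrt)).eventually
      (gt_mem_nhds ((add_zero _).trans_lt (gaussianReal_real_Iic_lt hε hV hδ)))
  filter_upwards [hlow, hup, hsqrt.eventually_ge_atTop (relD q)] with n hlow hup hn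
  simp only [Function.comp_apply] at hup
  set x := n * relD p + √n * (√(entVar p) * PhiInv ε) with hx
  have hxp : x = n * Real.log d - n * shannonH p + √n * (√(entVar p) * PhiInv ε) := by
    rw [hx, relD]; ring
  have hbound : ∀ m ∈ {m : ℕ | Convertible p q ε n m}, (m : ℝ) * relD q < x + 2 * δ * √n := by
    intro m hm
    by_contra! hcon
    have h := hm.le_surprisalCDF_add (γ := √n * δ) hp hq hf
    have hmono := surprisalCDF_mono hp n (show n * Real.log d - m * relD q + √n * δ ≤
      n * shannonH p + √n * (√(entVar p) * -PhiInv ε + -δ) by linarith)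
    linarith
  have hne : {m : ℕ | Convertible p q ε n m}.Nonempty := ⟨0, convertible_zero hp hq hf hε.1.le⟩
  have hbdd : BddAbove {m : ℕ | Convertible p q ε n m} := by
    refine ⟨⌊(x + 2 * δ * √n) / relD q⌋₊, fun m hm => Nat.le_floor ?_⟩
    rw [le_div_iff₀ hDq]
    exact (hbound m hm).le
  have hM := hbound _ (Nat.sSup_mem hne hbdd)
  set M := sSup {m : ℕ | Convertible p q ε n m}
  have hMlow : x - √n * δ - relD q < M * relD q := by
    rcases lt_or_ge (x - √n * δ) 0 with hneg | hnonneg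
    · have : 0 ≤ (M : ℝ) * relD q := by positivity
      linarith
    have hfloor := Nat.floor_le (div_nonneg hnonneg hDq.le)
    rw [le_div_iff₀ hDq] at hfloor
    have hmem : ⌊(x - √n * δ) / relD q⌋₊ ∈ {m : ℕ | Convertible p q ε n m} :=
      convertible_of_le_surprisalCDF hp hq hf
        (hlow.le.trans (surprisalCDF_mono hp n (by linarith)))
    have hle : ((⌊(x - √n * δ) / relD q⌋₊ : ℕ) : ℝ) ≤ M := Nat.cast_le.2 (le_csSup hbdd hmem)
    have hlt := Nat.lt_floor_add_one ((x - √n * δ) / relD q)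
    rw [div_lt_iff₀ hDq] at hlt
    nlinarith
  rw [abs_le]
  constructor <;> linarith

/-- second-order expansion for distillation: for flat `q` with
`D(q) > 0` and `ε ∈ (0,1)`,
`R*₀(n,ε) = (1/D(q))[D(p) + √(V(p)/n) Φ⁻¹(ε)] + o(1/√n)`. -/
theorem second_order_distillation
    {d : ℕ} (p q : Fin d → ℝ) (hp : IsProbVec p) (hq : IsProbVec q)
    (hqf : IsFlat q) (hDq : 0 < relD q)
    (ε : ℝ) (hε : ε ∈ Set.Ioo (0:ℝ) 1) :
    Filter.Tendsto (fun n : ℕ => Real.sqrt n *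
      (((sSup {m : ℕ | PostMaj ε
          (fun fg : (Fin n → Fin d) × (Fin m → Fin d) =>
            tensorPow p n fg.1 * tensorPow (fun _ : Fin d => (d : ℝ)⁻¹) m fg.2)
          (fun fg : (Fin m → Fin d) × (Fin n → Fin d) =>
            tensorPow q m fg.1 * tensorPow (fun _ : Fin d => (d : ℝ)⁻¹) n fg.2)} : ℕ) : ℝ)
          / n
        - (1 / relD q) * (relD p + Real.sqrt (entVar p / n) * PhiInv ε)))
      Filter.atTop (nhds 0) := by
  rw [Metric.tendsto_nhds]
  intro η hη
  have hδ : 0 < η * relD q / 4 := by positivity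
  filter_upwards [eventually_abs_sSup_convertible_le hp hq hqf hDq hε hδ,
    eventually_gt_atTop 0] with n hn hn0
  simp only [Convertible] at hn
  rw [Real.dist_eq, sub_zero]
  generalize (sSup _ : ℕ) = M at hn ⊢
  have hnpos : (0 : ℝ) < n := by exact_mod_cast hn0
  have hs : 0 < √(n : ℝ) := Real.sqrt_pos.2 hnpos
  have hsq : √(n : ℝ) ^ 2 = n := Real.sq_sqrt hnpos.le
  have heq : √(n : ℝ) * ((M : ℝ) / n -
      (1 / relD q) * (relD p + √(entVar p / n) * PhiInv ε)) =
      (M * relD q - (n * relD p + √n * (√(entVar p) * PhiInv ε))) / (relD q * √n) := by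
    rw [Real.sqrt_div (entVar_nonneg hp)]
    set s := √(n : ℝ)
    rw [← hsq]
    field_simp
  rw [heq, abs_div, abs_of_pos (mul_pos hDq hs), div_lt_iff₀ (mul_pos hDq hs)]
  refine hn.trans_lt ?_
  nlinarith [mul_pos hη (mul_pos hDq hs)]
end
end
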